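/- arXiv:2604.17146 — 3 statements merged into one kernel-verified Lean document; each statement's English description precedes it below -/
import Mathlib

section
/- Let α, β, γ be integers and let n, k, ℓ be nonnegative integers with k ≥ 1 and ℓ ≥ 1. Then S^{≤ℓ}_{α,β,γ}(n+1, k) = γ · S^{≤ℓ}_{α,β,γ−α}(n, k) + Σ_{i = max(0, n+1−ℓ)}^{n} C(n,i) · (β−α)_{n−i,α} · S^{≤ℓ}_{α,β,γ}(i, k−1), where C(n,i) is the binomial coefficient. -/
open Finset
open scoped Classical

/-- Degenerate falling factorial `(t)_{m,λ} = t(t-λ)⋯(t-(m-1)λ)`. -/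
def dff {R : Type*} [CommRing R] (t : R) (m : ℕ) (lam : R) : R :=
  ∏ i ∈ Finset.range m, (t - (i : R) * lam)

/-- `P` is a set partition of the finset `S` into `k` nonempty blocks. -/
def IsPartitionInto {n : ℕ} (S : Finset (Fin n)) (k : ℕ)
    (P : Finset (Finset (Fin n))) : Prop :=
  P.card = k ∧ (∀ B ∈ P, B.Nonempty) ∧
    (∀ B ∈ P, ∀ C ∈ P, B ≠ C → Disjoint B C) ∧ P.sup id = S

/-- Generalized Stirling number `S_{α,β,γ}(n,k)`: weighted sum over pairs `(G,P)`
where `G ⊆ [n]` and `P` partitions `[n] \ G` into `k` nonempty blocks, with weight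
`(γ)_{|G|,α} · ∏_{B∈P} (β-α)_{|B|-1,α}`. -/
noncomputable def genStirling {R : Type*} [CommRing R] (a b g : R) (n k : ℕ) : R :=
  ∑ G : Finset (Fin n),
    ∑ P ∈ Finset.univ.filter (fun P => IsPartitionInto Gᶜ k P),
      dff g G.card a * ∏ B ∈ P, dff (b - a) (B.card - 1) a

/-- Restricted generalized Stirling number `S^{≤ℓ}_{α,β,γ}(n,k)`:
as `genStirling` but every block of `P` has at most `ℓ` elements. -/
noncomputable def genStirlingLe {R : Type*} [CommRing R] (a b g : R) (n k l : ℕ) : R :=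
  ∑ G : Finset (Fin n),
    ∑ P ∈ Finset.univ.filter
        (fun P => IsPartitionInto Gᶜ k P ∧ ∀ B ∈ P, B.card ≤ l),
      dff g G.card a * ∏ B ∈ P, dff (b - a) (B.card - 1) a

/-- `S^{>ℓ}_γ(n,k)`: weighted sum over pairs `(G,P)` where `P` partitions
`[n] \ G` into `k` nonempty blocks each of size `> ℓ`, with weight `γ^{|G|}`. -/
noncomputable def Sgt {R : Type*} [CommRing R] (g : R) (n k l : ℕ) : R :=
  ∑ G : Finset (Fin n),
    ∑ _P ∈ Finset.univ.filter
        (fun P : Finset (Finset (Fin n)) =>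
          IsPartitionInto Gᶜ k P ∧ ∀ B ∈ P, l < B.card),
      g ^ G.card

/-- Associated Stirling number of the second kind `S_{≥ℓ}(n,k)`: the number of
set partitions of `[n]` into `k` nonempty blocks each of size at least `ℓ`. -/
noncomputable def assocStirling (n k l : ℕ) : ℕ :=
  (Finset.univ.filter
    (fun P : Finset (Finset (Fin n)) =>
      IsPartitionInto Finset.univ k P ∧ ∀ B ∈ P, l ≤ B.card)).card

/-- Partial degenerate partition number `S^{γ,α,β}_{n,k,ℓ}`: weighted sum over
pairs `(G,P)` with weight `γ^{|G|} · ∏_{B∈P, |B|≤ℓ} (β-α)_{|B|-1,α}`. -/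
noncomputable def partialS {R : Type*} [CommRing R] (g a b : R) (n k l : ℕ) : R :=
  ∑ G : Finset (Fin n),
    ∑ P ∈ Finset.univ.filter (fun P => IsPartitionInto Gᶜ k P),
      g ^ G.card * ∏ B ∈ P, (if B.card ≤ l then dff (b - a) (B.card - 1) a else 1)

/-- `S^{≤ℓ}_{α,β}(n,k)`: sum over set partitions of `[n]` into `k` nonempty blocks
each with at most `ℓ` elements, of the weight `∏_{B∈P} (β-α)_{|B|-1,α}`. -/
noncomputable def SleRestr {R : Type*} [CommRing R] (a b : R) (n k l : ℕ) : R :=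
  ∑ P ∈ Finset.univ.filter
      (fun P : Finset (Finset (Fin n)) =>
        IsPartitionInto Finset.univ k P ∧ ∀ B ∈ P, B.card ≤ l),
    ∏ B ∈ P, dff (b - a) (B.card - 1) a

theorem dff_succ {R : Type*} [CommRing R] (t : R) (m : ℕ) (lam : R) :
    dff t (m + 1) lam = t * dff (t - lam) m lam := by
  unfold dff
  rw [Finset.prod_range_succ', mul_comm]
  congr 1
  · simp
  · refine Finset.prod_congr rfl fun i _ => ?_
    push_cast
    ring

/-- The sum over partitions of `S` into `k` nonempty blocks of the product of block weights `w`. -/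
noncomputable def partitionSum {R : Type*} [CommRing R] {n : ℕ} (w : ℕ → R)
    (S : Finset (Fin n)) (k : ℕ) : R :=
  ∑ P ∈ Finset.univ.filter (fun P => IsPartitionInto S k P), ∏ B ∈ P, w B.card

/-- The value of `partitionSum` on a set of given cardinality, by recursion on the number of
blocks, removing the block that contains a chosen element. -/
def partitionNumber {R : Type*} [CommRing R] (w : ℕ → R) : ℕ → ℕ → R
  | 0, n => if n = 0 then 1 else 0
  | _ + 1, 0 => 0
  | k + 1, n + 1 =>
    ∑ j ∈ Finset.range (n + 1), (n.choose j : R) * (w (j + 1) * partitionNumber w k (n - j))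

theorem isPartitionInto_iff {n : ℕ} {S : Finset (Fin n)} {k : ℕ} {P : Finset (Finset (Fin n))} :
    IsPartitionInto S k P ↔ P.card = k ∧ (∀ B ∈ P, B.Nonempty) ∧
      (∀ B ∈ P, ∀ C ∈ P, ∀ y ∈ B, y ∈ C → B = C) ∧ ∀ y, y ∈ S ↔ ∃ B ∈ P, y ∈ B := by
  unfold IsPartitionInto
  refine and_congr_right' (and_congr_right' (and_congr ?_ ?_))
  · refine forall₄_congr fun B _ C _ => ?_
    rw [← not_imp_not, not_not, Finset.not_disjoint_iff]
    grind
  · rw [Finset.ext_iff]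
    simp only [Finset.mem_sup, id]
    exact forall_congr' fun y => ⟨Iff.symm, Iff.symm⟩

theorem IsPartitionInto.insert_block {n : ℕ} {S B : Finset (Fin n)} {k : ℕ} {x : Fin n}
    {Q : Finset (Finset (Fin n))} (hx : x ∉ S) (hB : B ⊆ S) (hQ : IsPartitionInto (S \ B) k Q) :
    insert x B ∉ Q ∧ IsPartitionInto (insert x S) (k + 1) (insert (insert x B) Q) := by
  rw [isPartitionInto_iff] at hQ
  obtain ⟨hc, hne, hd, hs⟩ := hQ
  have hsub : ∀ C ∈ Q, ∀ y ∈ C, y ∈ S ∧ y ∉ B := fun C hC y hy =>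
    Finset.mem_sdiff.1 ((hs y).2 ⟨C, hC, hy⟩)
  have hnot : insert x B ∉ Q := fun h => hx (hsub _ h x (Finset.mem_insert_self x B)).1
  refine ⟨hnot, isPartitionInto_iff.2 ⟨?_, ?_, ?_, ?_⟩⟩
  · rw [Finset.card_insert_of_notMem hnot, hc]
  · intro C hC
    rcases Finset.mem_insert.1 hC with rfl | hC
    · exact Finset.insert_nonempty x B
    · exact hne C hC
  · grind
  · intro y
    simp only [Finset.mem_insert, or_and_right, exists_or, exists_eq_left, ← hs,
      Finset.mem_sdiff]
    have := @hB y
    tauto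

theorem IsPartitionInto.erase_block {n : ℕ} {S C : Finset (Fin n)} {k : ℕ} {x : Fin n}
    {P : Finset (Finset (Fin n))} (hx : x ∉ S) (hP : IsPartitionInto (insert x S) (k + 1) P)
    (hC : C ∈ P) (hxC : x ∈ C) :
    C.erase x ⊆ S ∧ IsPartitionInto (S \ C.erase x) k (P.erase C) := by
  rw [isPartitionInto_iff] at hP
  obtain ⟨hc, hne, hd, hs⟩ := hP
  refine ⟨?_, isPartitionInto_iff.2 ⟨?_, ?_, ?_, ?_⟩⟩
  · intro y hy
    have := (hs y).2 ⟨C, hC, Finset.mem_of_mem_erase hy⟩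
    grind
  · rw [Finset.card_erase_of_mem hC, hc, Nat.add_sub_cancel]
  · exact fun B hB => hne B (Finset.mem_of_mem_erase hB)
  · exact fun B hB D hD =>
      hd B (Finset.mem_of_mem_erase hB) D (Finset.mem_of_mem_erase hD)
  · intro y
    have hy := hs y
    constructor
    · intro h
      obtain ⟨B, hB, hyB⟩ := hy.1 (by grind)
      exact ⟨B, by grind, hyB⟩
    · rintro ⟨B, hB, hyB⟩
      have hBP := Finset.mem_of_mem_erase hB
      have h1 := hy.2 ⟨B, hBP, hyB⟩
      have h2 := hd B hBP C hC y hyB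
      have h3 := hd B hBP C hC x
      grind

theorem partitionSum_insert {R : Type*} [CommRing R] {n : ℕ} (w : ℕ → R)
    {S : Finset (Fin n)} {x : Fin n} (hx : x ∉ S) (k : ℕ) :
    partitionSum w (insert x S) (k + 1) =
      ∑ B ∈ S.powerset, w (B.card + 1) * partitionSum w (S \ B) k := by
  unfold partitionSum
  simp only [Finset.mul_sum]
  rw [Finset.sum_sigma']
  symm
  refine Finset.sum_bij (fun p _ => insert (insert x p.1) p.2) ?_ ?_ ?_ ?_
  · rintro ⟨B, Q⟩ h
    simp only [Finset.mem_sigma, Finset.mem_powerset, Finset.mem_filter, Finset.mem_univ,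
      true_and] at h ⊢
    exact (h.2.insert_block hx h.1).2
  · rintro ⟨B, Q⟩ h ⟨B', Q'⟩ h' heq
    simp only [Finset.mem_sigma, Finset.mem_powerset, Finset.mem_filter, Finset.mem_univ,
      true_and] at h h' heq
    have hQ := h.2.insert_block hx h.1
    have hQ' := h'.2.insert_block hx h'.1
    have hblock : insert x B = insert x B' :=
      (isPartitionInto_iff.1 hQ.2).2.2.1 _ (Finset.mem_insert_self _ _) _
        (heq ▸ Finset.mem_insert_self _ _) x (Finset.mem_insert_self _ _)
        (Finset.mem_insert_self _ _)
    have hB : B = B' := by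
      rw [← Finset.erase_insert (fun hb => hx (h.1 hb)), hblock,
        Finset.erase_insert (fun hb => hx (h'.1 hb))]
    subst hB
    have : Q = Q' := by
      rw [← Finset.erase_insert hQ.1, heq, Finset.erase_insert hQ'.1]
    rw [this]
  · intro P hP
    simp only [Finset.mem_filter, Finset.mem_univ, true_and] at hP
    obtain ⟨C, hC, hxC⟩ := ((isPartitionInto_iff.1 hP).2.2.2 x).1 (Finset.mem_insert_self _ _)
    have h := hP.erase_block hx hC hxC
    refine ⟨⟨C.erase x, P.erase C⟩, ?_, ?_⟩
    · simpa only [Finset.mem_sigma, Finset.mem_powerset, Finset.mem_filter, Finset.mem_univ,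
        true_and] using h
    · simp only [Finset.insert_erase hxC, Finset.insert_erase hC]
  · rintro ⟨B, Q⟩ h
    simp only [Finset.mem_sigma, Finset.mem_powerset, Finset.mem_filter, Finset.mem_univ,
      true_and] at h ⊢
    rw [Finset.prod_insert (h.2.insert_block hx h.1).1,
      Finset.card_insert_of_notMem (fun hb => hx (h.1 hb))]

theorem partitionSum_zero {R : Type*} [CommRing R] {n : ℕ} (w : ℕ → R) (S : Finset (Fin n)) :
    partitionSum w S 0 = if S.card = 0 then 1 else 0 := by
  have h : ∀ P, IsPartitionInto S 0 P ↔ P = ∅ ∧ S = ∅ := by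
    intro P
    unfold IsPartitionInto
    rw [Finset.card_eq_zero]
    constructor
    · rintro ⟨rfl, -, -, h⟩
      exact ⟨rfl, by simpa using h.symm⟩
    · rintro ⟨rfl, rfl⟩
      simp
  unfold partitionSum
  simp only [h, Finset.card_eq_zero]
  by_cases hS : S = ∅ <;> simp [hS, Finset.sum_filter]

theorem partitionSum_empty_succ {R : Type*} [CommRing R] {n : ℕ} (w : ℕ → R) (k : ℕ) :
    partitionSum w (∅ : Finset (Fin n)) (k + 1) = 0 := by
  refine Finset.sum_eq_zero fun P hP => ?_
  obtain ⟨hc, hne, -, hs⟩ := isPartitionInto_iff.1 (Finset.mem_filter.1 hP).2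
  obtain ⟨B, hB⟩ := Finset.card_pos.1 (k.succ_pos.trans_eq hc.symm)
  obtain ⟨y, hy⟩ := hne B hB
  exact absurd ((hs y).2 ⟨B, hB, hy⟩) (Finset.notMem_empty y)

theorem sum_powerset_card_mul {R : Type*} [CommRing R] {V : Type*} [DecidableEq V]
    (f h : ℕ → R) (S : Finset V) :
    ∑ B ∈ S.powerset, f B.card * h (S \ B).card =
      ∑ j ∈ Finset.range (S.card + 1), (S.card.choose j : R) * (f j * h (S.card - j)) := by
  simp only [← nsmul_eq_mul]
  rw [← Finset.sum_powerset_apply_card (fun j => f j * h (S.card - j))]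
  refine Finset.sum_congr rfl fun B hB => ?_
  rw [Finset.card_sdiff_of_subset (Finset.mem_powerset.1 hB)]

theorem partitionSum_eq_partitionNumber {R : Type*} [CommRing R] {n : ℕ} (w : ℕ → R) (k : ℕ)
    (S : Finset (Fin n)) : partitionSum w S k = partitionNumber w k S.card := by
  induction k generalizing S with
  | zero => rw [partitionSum_zero, partitionNumber]
  | succ k ih =>
    rcases S.eq_empty_or_nonempty with rfl | ⟨x, hx⟩
    · rw [partitionSum_empty_succ, Finset.card_empty, partitionNumber]
    · have hx' := Finset.notMem_erase x S
      rw [← Finset.insert_erase hx, partitionSum_insert w hx',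
        Finset.card_insert_of_notMem hx', partitionNumber]
      simp only [ih]
      exact sum_powerset_card_mul (fun j => w (j + 1)) (partitionNumber w k) _

/-- The weight of a block of given size, vanishing on blocks with more than `l` elements. -/
def blockWeight {R : Type*} [CommRing R] (a b : R) (l c : ℕ) : R :=
  if c ≤ l then dff (b - a) (c - 1) a else 0

theorem genStirlingLe_eq_sum {R : Type*} [CommRing R] (a b g : R) (n k l : ℕ) :
    genStirlingLe a b g n k l = ∑ m ∈ Finset.range (n + 1),
      (n.choose m : R) * (dff g m a * partitionNumber (blockWeight a b l) k (n - m)) := by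
  have h := sum_powerset_card_mul (fun m => dff g m a) (partitionNumber (blockWeight a b l) k)
    (Finset.univ : Finset (Fin n))
  rw [Finset.card_univ, Fintype.card_fin] at h
  rw [← h, Finset.powerset_univ]
  unfold genStirlingLe
  refine Finset.sum_congr rfl fun G _ => ?_
  rw [← Finset.compl_eq_univ_sdiff, ← partitionSum_eq_partitionNumber, ← Finset.mul_sum]
  congr 1
  unfold partitionSum blockWeight
  rw [← Finset.filter_filter, Finset.sum_filter]
  refine Finset.sum_congr rfl fun P _ => ?_
  rw [Finset.prod_ite_zero]
  congr

theorem sum_choose_mul_sum_choose_comm {R : Type*} [CommRing R] (f u t : ℕ → R) (n : ℕ) :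
    ∑ m ∈ Finset.range (n + 1), (n.choose m : R) * (f m *
        ∑ j ∈ Finset.range (n - m + 1), ((n - m).choose j : R) * (u j * t (n - m - j))) =
      ∑ j ∈ Finset.range (n + 1), (n.choose j : R) * (u j *
        ∑ m ∈ Finset.range (n - j + 1), ((n - j).choose m : R) * (f m * t (n - j - m))) := by
  have key : ∀ f u : ℕ → R, ∑ m ∈ Finset.range (n + 1), (n.choose m : R) * (f m *
        ∑ j ∈ Finset.range (n - m + 1), ((n - m).choose j : R) * (u j * t (n - m - j))) =
      ∑ G ∈ (Finset.univ : Finset (Fin n)).powerset, ∑ B ∈ (Finset.univ \ G).powerset,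
        f G.card * (u B.card * t ((Finset.univ \ G) \ B).card) := by
    intro f u
    have h := sum_powerset_card_mul f (fun r => ∑ j ∈ Finset.range (r + 1),
      (r.choose j : R) * (u j * t (r - j))) (Finset.univ : Finset (Fin n))
    rw [Finset.card_univ, Fintype.card_fin] at h
    rw [← h]
    simp only [← sum_powerset_card_mul, Finset.mul_sum]
  rw [key, key, Finset.sum_comm' (t' := (Finset.univ : Finset (Fin n)).powerset)
    (s' := fun B => (Finset.univ \ B).powerset)]
  · refine Finset.sum_congr rfl fun B _ => Finset.sum_congr rfl fun G _ => ?_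
    rw [sdiff_right_comm]
    ring
  · intro G B
    simp only [Finset.powerset_univ, Finset.mem_univ, true_and, and_true, Finset.mem_powerset,
      Finset.subset_sdiff, Finset.subset_univ]
    exact disjoint_comm

theorem genStirlingLe_succ {R : Type*} [CommRing R] (a b g : R) (n k l : ℕ) :
    genStirlingLe a b g (n + 1) (k + 1) l =
      g * genStirlingLe a b (g - a) n (k + 1) l +
        ∑ j ∈ Finset.range (n + 1),
          (n.choose j : R) * (blockWeight a b l (j + 1) * genStirlingLe a b g (n - j) k l) := by
  simp only [genStirlingLe_eq_sum]
  rw [← sum_choose_mul_sum_choose_comm (fun m => dff g m a)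
    (fun j => blockWeight a b l (j + 1)) (partitionNumber (blockWeight a b l) k) n,
    Finset.sum_range_succ']
  have hsplit : ∀ m, ((n + 1).choose (m + 1) : R) = n.choose m + n.choose (m + 1) := by
    intro m
    rw [Nat.choose_succ_succ]
    push_cast
    rfl
  simp only [hsplit, add_mul, Finset.sum_add_distrib]
  rw [add_assoc]
  congr 1
  · rw [Finset.mul_sum]
    refine Finset.sum_congr rfl fun m _ => ?_
    rw [dff_succ, Nat.add_sub_add_right]
    ring
  · have h := Finset.sum_range_succ' (fun m => (n.choose m : R) *
      (dff g m a * partitionNumber (blockWeight a b l) (k + 1) (n + 1 - m))) (n + 1)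
    rw [Finset.sum_range_succ] at h
    simp only [Nat.choose_succ_self, Nat.cast_zero, zero_mul, add_zero, Nat.choose_zero_right]
      at h ⊢
    rw [← h]
    refine Finset.sum_congr rfl fun m hm => ?_
    rw [Nat.succ_sub (Nat.lt_succ_iff.1 (Finset.mem_range.1 hm)), Nat.succ_eq_add_one,
      partitionNumber]

theorem stmt0 (a b g : ℤ) (n k l : ℕ) (hk : 1 ≤ k) (hl : 1 ≤ l) :
    genStirlingLe a b g (n + 1) k l =
      g * genStirlingLe a b (g - a) n k l +
        ∑ i ∈ Finset.Icc (n + 1 - l) n,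
          (n.choose i : ℤ) * dff (b - a) (n - i) a * genStirlingLe a b g i (k - 1) l := by
  obtain ⟨k, rfl⟩ := Nat.exists_eq_add_of_le' hk
  rw [genStirlingLe_succ, Nat.add_sub_cancel, ← Finset.sum_range_reflect]
  congr 1
  have hIcc : Finset.Icc (n + 1 - l) n =
      (Finset.range (n + 1)).filter (fun i => n - i + 1 ≤ l) := by
    ext i
    simp only [Finset.mem_Icc, Finset.mem_filter, Finset.mem_range]
    omega
  rw [hIcc, Finset.sum_filter]
  refine Finset.sum_congr rfl fun i hi => ?_
  have hin : i ≤ n := Nat.lt_succ_iff.1 (Finset.mem_range.1 hi)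
  rw [Nat.add_sub_cancel, Nat.choose_symm hin, Nat.sub_sub_self hin, blockWeight]
  split_ifs <;> simp [mul_assoc]
end

section
/- Let γ be an integer and let n, k, ℓ be nonnegative integers with ℓ ≥ 1. Then S_{≥ℓ}(n, k) = Σ_{i=0}^{n} (−1)^i γ^i C(n,i) S^{>ℓ−1}_γ(n−i, k), where C(n,i) is the binomial coefficient. -/
open Finset
open scoped Classical

/-- Relabelling along an embedding preserves being a set partition into `k` blocks. -/
lemma isPartitionInto_map_iff {m n : ℕ} (e : Fin m ↪ Fin n) (S : Finset (Fin m)) (k : ℕ)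
    (Q : Finset (Finset (Fin m))) :
    IsPartitionInto (S.map e) k (Q.map (mapEmbedding e).toEmbedding) ↔
      IsPartitionInto S k Q := by
  have hsup : (Q.map (mapEmbedding e).toEmbedding).sup id = (Q.sup id).map e := by
    ext x
    simp only [Finset.mem_sup, Finset.mem_map, id]
    constructor
    · rintro ⟨_, ⟨B, hB, rfl⟩, hx⟩
      obtain ⟨y, hy, rfl⟩ := Finset.mem_map.1 hx
      exact ⟨y, ⟨B, hB, hy⟩, rfl⟩
    · rintro ⟨y, ⟨B, hB, hy⟩, rfl⟩
      exact ⟨_, ⟨B, hB, rfl⟩, Finset.mem_map_of_mem e hy⟩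
  unfold IsPartitionInto
  rw [hsup, Finset.map_inj]
  simp [Finset.disjoint_map]

/-- The number of set partitions of a finset into `k` blocks of size at least `l`
depends only on the cardinality of the finset. -/
lemma card_filter_isPartitionInto {n : ℕ} (S : Finset (Fin n)) (k l : ℕ) :
    (Finset.univ.filter (fun P : Finset (Finset (Fin n)) =>
      IsPartitionInto S k P ∧ ∀ B ∈ P, l ≤ B.card)).card = assocStirling S.card k l := by
  set e : Fin S.card ↪ Fin n := (S.orderEmbOfFin rfl).toEmbedding
  have hS : Finset.univ.map e = S := Finset.map_orderEmbOfFin_univ S rfl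
  have hmap := isPartitionInto_map_iff e Finset.univ k
  rw [hS] at hmap
  unfold assocStirling
  rw [← Finset.card_map (mapEmbedding (mapEmbedding e).toEmbedding).toEmbedding]
  congr 1
  ext P
  simp only [Finset.mem_filter, Finset.mem_univ, true_and, Finset.mem_map]
  constructor
  · rintro ⟨hP, hl⟩
    have hsub : P ⊆ Finset.univ.map (mapEmbedding e).toEmbedding := by
      intro B hB
      have hBS : B ⊆ Finset.univ.map e := by
        rw [hS, ← hP.2.2.2]
        exact Finset.le_sup (f := id) hB
      obtain ⟨C, -, rfl⟩ := Finset.subset_map_iff.1 hBS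
      exact Finset.mem_map_of_mem _ (Finset.mem_univ C)
    obtain ⟨Q, -, rfl⟩ := Finset.subset_map_iff.1 hsub
    exact ⟨Q, ⟨(hmap Q).1 hP, by simpa using hl⟩, rfl⟩
  · rintro ⟨Q, ⟨hQ, hl⟩, rfl⟩
    exact ⟨(hmap Q).2 hQ, by simpa using hl⟩

lemma Sgt_eq_sum_range {R : Type*} [CommRing R] (g : R) (n k l : ℕ) :
    Sgt g n k l = ∑ i ∈ Finset.range (n + 1),
      g ^ i * (n.choose i : R) * (assocStirling (n - i) k (l + 1) : R) := by
  have h : ∀ G : Finset (Fin n),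
      ∑ _P ∈ Finset.univ.filter (fun P : Finset (Finset (Fin n)) =>
        IsPartitionInto Gᶜ k P ∧ ∀ B ∈ P, l < B.card), g ^ G.card =
      (fun i => g ^ i * (assocStirling (n - i) k (l + 1) : R)) G.card := by
    intro G
    have hc := card_filter_isPartitionInto Gᶜ k (l + 1)
    rw [Finset.card_compl, Fintype.card_fin] at hc
    simp only [← hc, Finset.sum_const, nsmul_eq_mul, Nat.succ_le_iff]
    rw [mul_comm]
  unfold Sgt
  rw [Finset.sum_congr rfl fun G _ => h G, ← Finset.powerset_univ,
    Finset.sum_powerset_apply_card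
      (fun i => g ^ i * (assocStirling (n - i) k (l + 1) : R)), Finset.card_univ, Fintype.card_fin]
  refine Finset.sum_congr rfl fun i _ => ?_
  rw [nsmul_eq_mul]
  ring

/-- Binomial inversion with a parameter: the binomial transforms with parameters
`g` and `-g` are inverse to each other. -/
lemma sum_range_binomial_inversion {R : Type*} [CommRing R] (g : R) (f : ℕ → R) (n : ℕ) :
    ∑ i ∈ Finset.range (n + 1), (-g) ^ i * (n.choose i : R) *
      ∑ j ∈ Finset.range (n - i + 1), g ^ j * ((n - i).choose j : R) * f (n - i - j) = f n := by
  let φ : Polynomial R →ₗ[R] R := (Polynomial.basisMonomials R).constr R f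
  have hφ : ∀ m, φ (Polynomial.X ^ m) = f m := fun m => by
    rw [← Polynomial.monomial_one_right_eq_X_pow,
      ← congrFun (Polynomial.coe_basisMonomials (R := R)) m]
    exact (Polynomial.basisMonomials R).constr_basis R f m
  have key : ∀ (p : Polynomial R) (c : R) (m : ℕ), φ ((Polynomial.C c + p) ^ m) =
      ∑ i ∈ Finset.range (m + 1), c ^ i * (m.choose i : R) * φ (p ^ (m - i)) := by
    intro p c m
    rw [add_pow, map_sum]
    refine Finset.sum_congr rfl fun i _ => ?_
    rw [← smul_eq_mul (a := c ^ i * _), ← map_smul, Polynomial.smul_eq_C_mul]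
    congr 1
    simp only [map_mul, map_pow, map_natCast]
    ring
  simp only [← hφ, ← key]
  congr 2
  simp

theorem stmt4 (g : ℤ) (n k l : ℕ) (hl : 1 ≤ l) :
    (assocStirling n k l : ℤ) =
      ∑ i ∈ Finset.range (n + 1),
        (-1) ^ i * g ^ i * (n.choose i : ℤ) * Sgt g (n - i) k (l - 1) := by
  simp only [Sgt_eq_sum_range, Nat.sub_add_cancel hl, ← mul_pow, neg_one_mul]
  exact (sum_range_binomial_inversion g (fun m => (assocStirling m k l : ℤ)) n).symm
end

section
/- Let α, β, γ be integers and let n, k, ℓ be nonnegative integers. Then S^{γ,α,β}_{n,k,ℓ} = Σ_{i=0}^{n} Σ_{j=0}^{k} C(n,i) · S^{>ℓ}_γ(i, j) · S^{≤ℓ}_{α,β}(n−i, k−j), where C(n,i) is the binomial coefficient. -/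
open Finset
open scoped Classical

namespace IsPartitionInto

variable {m n : ℕ}

lemma mem_iff {S : Finset (Fin n)} {k : ℕ} {P : Finset (Finset (Fin n))}
    (h : IsPartitionInto S k P) (x : Fin n) : x ∈ S ↔ ∃ B ∈ P, x ∈ B := by
  rw [← h.2.2.2, Finset.mem_sup]
  rfl

lemma subset {S : Finset (Fin n)} {k : ℕ} {P : Finset (Finset (Fin n))}
    (h : IsPartitionInto S k P) {B : Finset (Fin n)} (hB : B ∈ P) : B ⊆ S :=
  fun x hx => (h.mem_iff x).2 ⟨B, hB, hx⟩

lemma disjoint_blocks {V W : Finset (Fin n)} {j k : ℕ} {P Q : Finset (Finset (Fin n))}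
    (hP : IsPartitionInto V j P) (hQ : IsPartitionInto W k Q) (hd : Disjoint V W) :
    Disjoint P Q := by
  rw [Finset.disjoint_left]
  intro B hB hB'
  obtain ⟨x, hx⟩ := hP.2.1 B hB
  exact Finset.disjoint_left.1 hd (hP.subset hB hx) (hQ.subset hB' hx)

lemma union {V W : Finset (Fin n)} {j k : ℕ} {P Q : Finset (Finset (Fin n))}
    (hP : IsPartitionInto V j P) (hQ : IsPartitionInto W k Q) (hd : Disjoint V W) :
    IsPartitionInto (V ∪ W) (j + k) (P ∪ Q) := by
  refine ⟨?_, ?_, ?_, ?_⟩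
  · rw [Finset.card_union_of_disjoint (hP.disjoint_blocks hQ hd), hP.1, hQ.1]
  · intro B hB
    rcases Finset.mem_union.1 hB with hB | hB
    · exact hP.2.1 B hB
    · exact hQ.2.1 B hB
  · intro B hB C hC hne
    rcases Finset.mem_union.1 hB with hB | hB <;> rcases Finset.mem_union.1 hC with hC | hC
    · exact hP.2.2.1 B hB C hC hne
    · exact Disjoint.mono (hP.subset hB) (hQ.subset hC) hd
    · exact Disjoint.mono (hQ.subset hB) (hP.subset hC) hd.symm
    · exact hQ.2.2.1 B hB C hC hne
  · rw [Finset.sup_union, hP.2.2.2, hQ.2.2.2]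
    rfl

lemma filter {S : Finset (Fin n)} {k : ℕ} {P : Finset (Finset (Fin n))}
    (h : IsPartitionInto S k P) (q : Finset (Fin n) → Prop) [DecidablePred q] :
    IsPartitionInto ((P.filter q).sup id) (P.filter q).card (P.filter q) :=
  ⟨rfl, fun B hB => h.2.1 B (Finset.mem_filter.1 hB).1,
    fun B hB C hC => h.2.2.1 B (Finset.mem_filter.1 hB).1 C (Finset.mem_filter.1 hC).1, rfl⟩

lemma filter_compl {S V : Finset (Fin n)} {j k : ℕ} {P : Finset (Finset (Fin n))}
    {q : Finset (Fin n) → Prop} [DecidablePred q] (h : IsPartitionInto S k P)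
    (hq : IsPartitionInto V j (P.filter q)) :
    IsPartitionInto (S \ V) (k - j) (P.filter fun B => ¬ q B) := by
  have h2 := h.filter fun B => ¬ q B
  refine ⟨?_, h2.2.1, h2.2.2.1, ?_⟩
  · have := Finset.card_filter_add_card_filter_not (s := P) q
    have h1 := hq.1
    have h0 := h.1
    omega
  · ext x
    rw [Finset.mem_sdiff, h.mem_iff, hq.mem_iff, Finset.mem_sup]
    simp only [Finset.mem_filter, id]
    constructor
    · rintro ⟨B, ⟨hB, hqB⟩, hx⟩
      refine ⟨⟨B, hB, hx⟩, ?_⟩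
      rintro ⟨C, ⟨hC, hqC⟩, hx'⟩
      have hne : B ≠ C := fun e => hqB (e ▸ hqC)
      exact Finset.disjoint_left.1 (h.2.2.1 B hB C hC hne) hx hx'
    · rintro ⟨⟨B, hB, hx⟩, hn⟩
      exact ⟨B, ⟨hB, fun hqB => hn ⟨B, ⟨hB, hqB⟩, hx⟩⟩, hx⟩

lemma map_iff (e : Fin m ↪ Fin n) {S : Finset (Fin m)} {k : ℕ} {P : Finset (Finset (Fin m))} :
    IsPartitionInto (S.map e) k (P.map (Finset.mapEmbedding e).toEmbedding) ↔
      IsPartitionInto S k P := by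
  have hsup : (P.map (Finset.mapEmbedding e).toEmbedding).sup id = (P.sup id).map e := by
    ext x
    simp only [Finset.mem_sup, Finset.mem_map, id]
    constructor
    · rintro ⟨_, ⟨B, hB, rfl⟩, hx⟩
      obtain ⟨y, hy, rfl⟩ := Finset.mem_map.1 hx
      exact ⟨y, ⟨B, hB, hy⟩, rfl⟩
    · rintro ⟨y, ⟨B, hB, hy⟩, rfl⟩
      exact ⟨_, ⟨B, hB, rfl⟩, Finset.mem_map_of_mem e hy⟩
  unfold IsPartitionInto
  rw [hsup, Finset.card_map, Finset.map_inj]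
  simp

end IsPartitionInto

/-- Partitions of the image of `S` under an embedding are the images of partitions of `S`. -/
lemma filter_isPartitionInto_map {m n : ℕ} (e : Fin m ↪ Fin n) (S : Finset (Fin m)) (k : ℕ) :
    Finset.univ.filter (IsPartitionInto (S.map e) k) =
      (Finset.univ.filter (IsPartitionInto S k)).map
        (Finset.mapEmbedding (Finset.mapEmbedding e).toEmbedding).toEmbedding := by
  ext Q
  simp only [Finset.mem_filter, Finset.mem_univ, true_and, Finset.mem_map]
  constructor
  · intro hQ
    have hQ' : Q ⊆ Finset.univ.map (Finset.mapEmbedding e).toEmbedding := by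
      intro B hB
      obtain ⟨C, -, rfl⟩ := Finset.subset_map_iff.1 (hQ.subset hB)
      exact Finset.mem_map_of_mem (Finset.mapEmbedding e).toEmbedding (Finset.mem_univ C)
    obtain ⟨P, -, rfl⟩ := Finset.subset_map_iff.1 hQ'
    exact ⟨P, (IsPartitionInto.map_iff e).1 hQ, rfl⟩
  · rintro ⟨P, hP, rfl⟩
    exact (IsPartitionInto.map_iff e).2 hP

lemma sum_isPartitionInto_map {M : Type*} [AddCommMonoid M] {m n : ℕ} (e : Fin m ↪ Fin n)
    (S : Finset (Fin m)) (k : ℕ) (q : ℕ → Prop) [DecidablePred q]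
    (w : Finset (Finset (Fin n)) → M) :
    ∑ P ∈ Finset.univ.filter
        (fun P => IsPartitionInto (S.map e) k P ∧ ∀ B ∈ P, q B.card), w P =
      ∑ P ∈ Finset.univ.filter (fun P => IsPartitionInto S k P ∧ ∀ B ∈ P, q B.card),
        w (P.map (Finset.mapEmbedding e).toEmbedding) := by
  rw [← Finset.filter_filter, ← Finset.filter_filter, filter_isPartitionInto_map,
    Finset.filter_map, Finset.sum_map]
  simp [Function.comp_def]

lemma exists_embedding_map_univ {n : ℕ} (S : Finset (Fin n)) :
    ∃ e : Fin S.card ↪ Fin n, Finset.univ.map e = S :=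
  ⟨(S.orderEmbOfFin rfl).toEmbedding, by simp⟩

lemma sleRestr_card {R : Type*} [CommRing R] (a b : R) {n : ℕ} (T : Finset (Fin n)) (k l : ℕ) :
    SleRestr a b T.card k l =
      ∑ P ∈ Finset.univ.filter
          (fun P : Finset (Finset (Fin n)) => IsPartitionInto T k P ∧ ∀ B ∈ P, B.card ≤ l),
        ∏ B ∈ P, dff (b - a) (B.card - 1) a := by
  obtain ⟨e, he⟩ := exists_embedding_map_univ T
  have := sum_isPartitionInto_map e Finset.univ k (· ≤ l)
    fun P => ∏ B ∈ P, dff (b - a) (B.card - 1) a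
  rw [he] at this
  rw [this, SleRestr]
  simp

lemma sgt_card {R : Type*} [CommRing R] (g : R) {n : ℕ} (S : Finset (Fin n)) (k l : ℕ) :
    Sgt g S.card k l =
      ∑ G ∈ S.powerset, ∑ _P ∈ Finset.univ.filter
          (fun P : Finset (Finset (Fin n)) =>
            IsPartitionInto (S \ G) k P ∧ ∀ B ∈ P, l < B.card),
        g ^ G.card := by
  obtain ⟨e, he⟩ := exists_embedding_map_univ S
  have hpow : S.powerset = Finset.univ.map (Finset.mapEmbedding e).toEmbedding := by
    ext G
    conv_lhs => rw [← he, Finset.mem_powerset, Finset.subset_map_iff]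
    simp [eq_comm]
  rw [hpow, Finset.sum_map, Sgt]
  refine Finset.sum_congr rfl fun G _ => ?_
  have hS : S \ (Finset.mapEmbedding e).toEmbedding G = Gᶜ.map e := by
    rw [Finset.compl_eq_univ_sdiff, Finset.map_sdiff, he]
    rfl
  rw [hS, sum_isPartitionInto_map e Gᶜ k (l < ·)]
  simp

/-- Splitting a partition of the complement of `G` into its large and small blocks, where `S` is
the union of `G` with the large blocks. -/
lemma sum_isPartitionInto_eq_sum_split {M : Type*} [AddCommMonoid M] {n : ℕ}
    (G : Finset (Fin n)) (k l : ℕ) (w : Finset (Finset (Fin n)) → M) :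
    ∑ P ∈ Finset.univ.filter (IsPartitionInto Gᶜ k), w P =
      ∑ S ∈ Finset.univ.filter (G ⊆ ·), ∑ j ∈ Finset.range (k + 1),
        ∑ P ∈ Finset.univ.filter
            (fun P => IsPartitionInto (S \ G) j P ∧ ∀ B ∈ P, l < B.card),
          ∑ Q ∈ Finset.univ.filter
              (fun Q => IsPartitionInto Sᶜ (k - j) Q ∧ ∀ B ∈ Q, B.card ≤ l),
            w (P ∪ Q) := by
  rw [← Finset.sum_fiberwise_of_maps_to (t := Finset.univ.filter (G ⊆ ·))
    (g := fun P => G ∪ (P.filter fun B => l < B.card).sup id) (by simp)]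
  refine Finset.sum_congr rfl fun S hS => ?_
  have hGS : G ⊆ S := by simpa using hS
  rw [← Finset.sum_fiberwise_of_maps_to (t := Finset.range (k + 1))
    (g := fun P => (P.filter fun B => l < B.card).card)]
  swap
  · intro P hP
    simp only [Finset.mem_filter, Finset.mem_univ, true_and] at hP
    rw [Finset.mem_range, Nat.lt_succ_iff, ← hP.1.1]
    exact Finset.card_filter_le _ _
  refine Finset.sum_congr rfl fun j hj => ?_
  have hjk : j ≤ k := Nat.lt_succ_iff.1 (Finset.mem_range.1 hj)
  rw [← Finset.sum_product']
  refine Finset.sum_bij'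
    (fun P _ => (P.filter (fun B => l < B.card), P.filter (fun B => ¬ l < B.card)))
    (fun PQ _ => PQ.1 ∪ PQ.2) ?_ ?_ ?_ ?_ ?_
  · intro P hP
    simp only [Finset.mem_filter, Finset.mem_univ, true_and] at hP
    obtain ⟨⟨hP, hPS⟩, hPj⟩ := hP
    have h1 := hP.filter fun B => l < B.card
    have hV : (P.filter fun B => l < B.card).sup id = S \ G := by
      have hd : Disjoint G ((P.filter fun B => l < B.card).sup id) := by
        rw [Finset.disjoint_right]
        intro x hx
        obtain ⟨B, hB, hxB⟩ := (h1.mem_iff x).1 hx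
        exact Finset.mem_compl.1 (hP.subset (Finset.mem_filter.1 hB).1 hxB)
      rw [← hPS, Finset.union_sdiff_cancel_left hd]
    rw [hV, hPj] at h1
    have h2 := hP.filter_compl h1
    have hW : Gᶜ \ (S \ G) = Sᶜ := by
      ext x
      have := @hGS x
      simp only [Finset.mem_sdiff, Finset.mem_compl]
      tauto
    rw [hW] at h2
    simp only [Finset.mem_product, Finset.mem_filter, Finset.mem_univ, true_and]
    exact ⟨⟨h1, fun B hB => hB.2⟩, h2, fun B hB => not_lt.1 hB.2⟩
  · rintro ⟨P, Q⟩ h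
    simp only [Finset.mem_product, Finset.mem_filter, Finset.mem_univ, true_and] at h
    obtain ⟨⟨hP, hPl⟩, hQ, hQl⟩ := h
    have hd : Disjoint (S \ G) Sᶜ :=
      Disjoint.mono_left Finset.sdiff_subset disjoint_compl_right
    have hU : (S \ G) ∪ Sᶜ = Gᶜ := by
      ext x
      have := @hGS x
      simp only [Finset.mem_sdiff, Finset.mem_compl, Finset.mem_union]
      tauto
    have h := hP.union hQ hd
    rw [hU, Nat.add_sub_cancel' hjk] at h
    have hf : (P ∪ Q).filter (fun B => l < B.card) = P := by
      rw [Finset.filter_union, Finset.filter_true_of_mem hPl,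
        Finset.filter_false_of_mem fun B hB => not_lt.2 (hQl B hB), Finset.union_empty]
    simp only [Finset.mem_filter, Finset.mem_univ, true_and, hf]
    refine ⟨⟨h, ?_⟩, hP.1⟩
    rw [hP.2.2.2, Finset.union_sdiff_of_subset hGS]
  · intro P _
    exact Finset.filter_union_filter_not_eq _ P
  · rintro ⟨P, Q⟩ h
    simp only [Finset.mem_product, Finset.mem_filter, Finset.mem_univ, true_and] at h
    obtain ⟨⟨-, hPl⟩, -, hQl⟩ := h
    refine Prod.ext ?_ ?_
    · change (P ∪ Q).filter (fun B => l < B.card) = P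
      rw [Finset.filter_union, Finset.filter_true_of_mem hPl,
        Finset.filter_false_of_mem fun B hB => not_lt.2 (hQl B hB), Finset.union_empty]
    · change (P ∪ Q).filter (fun B => ¬ l < B.card) = Q
      rw [Finset.filter_union, Finset.filter_false_of_mem fun B hB => not_not.2 (hPl B hB),
        Finset.filter_true_of_mem fun B hB => not_lt.2 (hQl B hB), Finset.empty_union]
  · intro P _
    exact congrArg w (Finset.filter_union_filter_not_eq _ P).symm

lemma prod_union_large_small {R : Type*} [CommRing R] {n l : ℕ} {P Q : Finset (Finset (Fin n))}
    (f : Finset (Fin n) → R) (hP : ∀ B ∈ P, l < B.card) (hQ : ∀ B ∈ Q, B.card ≤ l) :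
    ∏ B ∈ P ∪ Q, (if B.card ≤ l then f B else 1) = ∏ B ∈ Q, f B := by
  have hd : Disjoint P Q :=
    Finset.disjoint_left.2 fun B hB hB' => (hP B hB).not_ge (hQ B hB')
  rw [Finset.prod_union hd, Finset.prod_eq_one fun B hB => if_neg (hP B hB).not_ge, one_mul]
  exact Finset.prod_congr rfl fun B hB => if_pos (hQ B hB)

/-- The convolution formula, with the sum over `i` refined to a sum over subsets. -/
lemma partialS_eq_sum_finset {R : Type*} [CommRing R] (g a b : R) (n k l : ℕ) :
    partialS g a b n k l =
      ∑ S : Finset (Fin n), ∑ j ∈ Finset.range (k + 1),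
        Sgt g S.card j l * SleRestr a b (n - S.card) (k - j) l := by
  unfold partialS
  simp_rw [sum_isPartitionInto_eq_sum_split _ k l]
  rw [Finset.sum_comm' (t' := Finset.univ) (s' := fun S => S.powerset) (by simp)]
  refine Finset.sum_congr rfl fun S _ => ?_
  rw [Finset.sum_comm]
  refine Finset.sum_congr rfl fun j _ => ?_
  have hc : n - S.card = Sᶜ.card := by rw [Finset.card_compl, Fintype.card_fin]
  rw [hc, sgt_card, sleRestr_card, Finset.sum_mul]
  refine Finset.sum_congr rfl fun G _ => ?_
  rw [Finset.sum_mul_sum]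
  refine Finset.sum_congr rfl fun P hP => Finset.sum_congr rfl fun Q hQ => ?_
  rw [prod_union_large_small (fun B => dff (b - a) (B.card - 1) a)
    (Finset.mem_filter.1 hP).2.2 (Finset.mem_filter.1 hQ).2.2]

theorem stmt7 (a b g : ℤ) (n k l : ℕ) :
    partialS g a b n k l =
      ∑ i ∈ Finset.range (n + 1), ∑ j ∈ Finset.range (k + 1),
        (n.choose i : ℤ) * Sgt g i j l * SleRestr a b (n - i) (k - j) l := by
  rw [partialS_eq_sum_finset, ← Finset.powerset_univ, Finset.sum_powerset_apply_card
    (fun i => ∑ j ∈ Finset.range (k + 1), Sgt g i j l * SleRestr a b (n - i) (k - j) l),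
    Finset.card_univ, Fintype.card_fin]
  refine Finset.sum_congr rfl fun i _ => ?_
  rw [nsmul_eq_mul, Finset.mul_sum]
  exact Finset.sum_congr rfl fun j _ => (mul_assoc _ _ _).symm
end
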